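/- If all automorphisms of a unital C*-algebra A are approximately inner, then every automorphism α of A induces the trivial map on π₁(U(A)): for every based loop ũ in U(A), the loop α∘ũ is based-homotopic to ũ. -/

import Mathlib

theorem stmt19_approx {A : Type*} [CStarAlgebra A]
    (α : A ≃⋆ₐ[ℂ] A)
    (happrox : ∀ (F : Finset A) (ε : ℝ), 0 < ε →
      ∃ v ∈ unitary A, ∀ a ∈ F, ‖α a - v * a * star v‖ < ε)
    (u : C(unitInterval, unitary A)) :
    ∃ v : unitary A, ∀ t, ‖α (u t : A) - v * u t * star (v : A)‖ < 2 := by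
  classical
  have hK : IsCompact (Set.range fun t => (u t : A)) :=
    isCompact_range (by fun_prop)
  obtain ⟨T, hTs, hTf, hT⟩ := hK.finite_cover_balls (e := 1 / 2) (by norm_num)
  obtain ⟨v, hv, hvF⟩ := happrox hTf.toFinset 1 one_pos
  refine ⟨⟨v, hv⟩, fun t => ?_⟩
  obtain ⟨a, haT, hat⟩ := Set.mem_iUnion₂.1 (hT ⟨t, rfl⟩)
  have h1 := hvF a (by simpa using haT)
  have h2 : ‖(u t : A) - a‖ < 1 / 2 := by simpa [dist_eq_norm] using hat
  have h3 : ‖α ((u t : A) - a)‖ < 1 / 2 := by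
    rwa [StarAlgEquiv.norm_map]
  have h4 : ‖v * (a - (u t : A)) * star v‖ < 1 / 2 := by
    have e1 := CStarRing.norm_coe_unitary_mul ⟨v, hv⟩ (a - (u t : A))
    have e2 := CStarRing.norm_mul_coe_unitary (v * (a - (u t : A))) (star ⟨v, hv⟩)
    simp only [Unitary.coe_star] at e1 e2
    rw [e2, e1, norm_sub_rev]
    exact h2
  have key : α (u t : A) - v * u t * star v
      = α ((u t : A) - a) + (α a - v * a * star v) + v * (a - (u t : A)) * star v := by
    rw [map_sub]; noncomm_ring
  show ‖α (u t : A) - v * u t * star v‖ < 2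
  rw [key]
  have := norm_add₃_le (a := α ((u t : A) - a)) (b := α a - v * a * star v)
    (c := v * (a - (u t : A)) * star v)
  linarith

theorem stmt19_arg_one {A : Type*} [CStarAlgebra A] :
    Unitary.argSelfAdjoint (1 : unitary A) = 0 := by
  have := argSelfAdjoint_expUnitary (x := (0 : selfAdjoint A)) (by simpa using Real.pi_pos)
  simpa using this


/-- Remark `rmk:simplificationsobs`. If all automorphisms of a unital
C*-algebra `A` (with path connected unitary group) are approximately inner, then every
automorphism `α` induces the trivial map on `π₁(U(A))`: for every based loop `u` in
`U(A)`, the loop `α ∘ u` is based-homotopic to `u`. -/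
theorem stmt19 {A : Type*} [CStarAlgebra A]
    (hconn : PathConnectedSpace (unitary A))
    (happrox : ∀ (β : A ≃⋆ₐ[ℂ] A) (F : Finset A) (ε : ℝ), 0 < ε →
      ∃ v ∈ unitary A, ∀ a ∈ F, ‖β a - v * a * star v‖ < ε)
    (α : A ≃⋆ₐ[ℂ] A) (u : C(unitInterval, unitary A))
    (h0 : u 0 = 1) (h1 : u 1 = 1) :
    ∃ H : C(unitInterval × unitInterval, unitary A),
      (∀ t, ((H (0, t) : A)) = α ((u t : A))) ∧
      (∀ t, H (1, t) = u t) ∧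
      (∀ s, H (s, 0) = 1) ∧ (∀ s, H (s, 1) = 1) := by
  obtain ⟨v, hv⟩ := stmt19_approx α (happrox α) u
  obtain ⟨γ⟩ := hconn.joined v 1
  have hαc : Continuous α := (StarAlgEquiv.isometry α).continuous
  let p : unitInterval → unitary A := fun t => ⟨α (u t : A), Unitary.map_mem α (u t).2⟩
  have hpα : ∀ t, (p t : A) = α (u t : A) := fun t => rfl
  have hpc : Continuous p := by
    refine Continuous.subtype_mk (f := fun t => α (u t : A)) ?_ _
    exact hαc.comp (by fun_prop)
  have hp0 : p 0 = 1 := by ext; simp [hpα, h0]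
  have hp1 : p 1 = 1 := by ext; simp [hpα, h1]
  let q : unitInterval → unitary A := fun t => v * u t * star v
  have hqc : Continuous q := by fun_prop
  have hq0 : q 0 = 1 := by simp [q, h0]
  have hq1 : q 1 = 1 := by simp [q, h1]
  have hpq : ∀ t, ‖(p t : A) - q t‖ < 2 := fun t => hv t
  have hargc : Continuous fun t => Unitary.argSelfAdjoint (p t * star (q t)) := by
    refine Unitary.continuousOn_argSelfAdjoint.comp_continuous (by fun_prop) fun t => ?_
    have := hpq t
    rw [Unitary.norm_sub_eq] at this
    simpa [Subtype.dist_eq, dist_eq_norm] using this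
  refine ⟨⟨fun x => selfAdjoint.expUnitary ((1 - (x.1 : ℝ)) •
      Unitary.argSelfAdjoint (p x.2 * star (q x.2))) * (γ x.1 * u x.2 * star (γ x.1)), ?_⟩,
    ?_, ?_, ?_, ?_⟩
  · have := hargc.comp (continuous_snd (X := unitInterval))
    simp only [Function.comp_def] at this
    fun_prop
  · intro t
    rw [← hpα]
    congr 1
    simp only [ContinuousMap.coe_mk, Set.Icc.coe_zero, sub_zero, one_smul, Path.source]
    rw [Unitary.expUnitary_eq_mul_inv _ _ (hpq t)]
    change p t * star (q t) * q t = p t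
    simp [mul_assoc]
  · intro t
    simp
  · intro s
    simp [hp0, hq0, h0, stmt19_arg_one]
  · intro s
    simp [hp1, hq1, h1, stmt19_arg_one]
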